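/- arXiv:1304.0108 — 6 statements merged into one kernel-verified Lean document; each statement's English description precedes it below -/
import Mathlib

section
/- Let F and G be elements of the ring ℝ⟦X*⟧ of formal generalised power series in one variable (the Hahn series ring HahnSeries ℝ≥0 ℝ), with F ≠ 0 and G ≠ 0. If order(F) ≤ order(G), then F divides G in this ring. -/
namespace HahnSeries

variable {Γ R : Type*}

/-- A Hahn series supported in `[g, ∞)` is divisible by the monomial `single g 1`. -/
theorem single_one_dvd_of_forall_le [AddCommMonoid Γ] [LinearOrder Γ] [IsOrderedCancelAddMonoid Γ]
    [CanonicallyOrderedAdd Γ] [Semiring R] {g : Γ} {x : HahnSeries Γ R}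
    (hx : ∀ a ∈ x.support, g ≤ a) : single g 1 ∣ x := by
  have hpwo : (Function.support fun a => x.coeff (a + g)).IsPWO := by
    refine Set.IsWF.isPWO ?_
    rw [Set.isWF_iff_no_descending_seq]
    intro u hu hmem
    exact Set.isWF_iff_no_descending_seq.1 x.isWF_support (fun n => u n + g)
      (fun a b h => by simpa using hu h) hmem
  refine ⟨⟨fun a => x.coeff (a + g), hpwo⟩, ?_⟩
  ext a
  by_cases ha : g ≤ a
  · obtain ⟨b, rfl⟩ := exists_add_of_le ha
    rw [add_comm g b, coeff_single_mul_add, one_mul]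
  · rw [show x.coeff a = 0 from by_contra fun h => ha (hx a h), coeff_mul]
    refine (Finset.sum_eq_zero fun ij hij => ?_).symm
    rw [Finset.mem_antidiagonal] at hij
    by_cases hi : ij.1 = g
    · exact absurd (hij.2.2 ▸ hi ▸ le_self_add) ha
    · rw [coeff_single_of_ne hi, zero_mul]

end HahnSeries

/-- In the ring `ℝ⟦X*⟧ = HahnSeries ℝ≥0 ℝ` of formal generalised
power series in one variable, if `F, G ≠ 0` and `order F ≤ order G`, then
`F` divides `G`. -/
theorem hahnSeries_dvd_of_order_le (F G : HahnSeries NNReal ℝ)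
    (hF : F ≠ 0) (hG : G ≠ 0) (h : F.order ≤ G.order) : F ∣ G := by
  obtain ⟨U, hU⟩ := HahnSeries.single_one_dvd_of_forall_le (x := F) (g := F.order)
    fun a ha => HahnSeries.order_le_of_coeff_ne_zero ha
  have hU0 : U ≠ 0 := by
    rintro rfl
    exact hF (by simpa using hU)
  have hUorder : U.order = 0 := by
    have := congrArg HahnSeries.order hU
    rw [HahnSeries.order_mul (by simp) hU0, HahnSeries.order_single one_ne_zero] at this
    simpa using this
  have hUunit : IsUnit U := HahnSeries.isUnit_of_isUnit_leadingCoeff_AddUnitOrder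
    (by simpa using hU0) (by simp [hUorder])
  rw [hU, hUunit.mul_right_dvd]
  exact HahnSeries.single_one_dvd_of_forall_le
    fun a ha => h.trans (HahnSeries.order_le_of_coeff_ne_zero ha)
end

section
/- Every nonzero F in the ring ℝ⟦X*⟧ of formal generalised power series in one variable (the Hahn series ring HahnSeries ℝ≥0 ℝ) is normal: F = X^γ · U, where γ = order(F), X^γ denotes the monomial Hahn series with single coefficient 1 at exponent γ, and U is a unit of the ring. -/
namespace HahnSeries

/-- Division of a Hahn series by the monomial with exponent `g`, discarding all terms whose
exponent is not of the form `g + a`. -/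
def divMonomial {Γ R : Type*} [AddCommMonoid Γ] [PartialOrder Γ] [IsOrderedCancelAddMonoid Γ]
    [Zero R] (g : Γ) (x : HahnSeries Γ R) : HahnSeries Γ R where
  coeff a := x.coeff (g + a)
  isPWO_support' := by
    refine Set.isPWO_iff_exists_monotone_subseq.2 fun f hf => ?_
    obtain ⟨n, hn⟩ := x.isPWO_support.exists_monotone_subseq (f := fun k => g + f k) hf
    exact ⟨n, fun _ _ h => le_of_add_le_add_left (hn h)⟩

theorem single_mul_divMonomial_order {Γ R : Type*} [AddCommMonoid Γ] [LinearOrder Γ]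
    [IsOrderedCancelAddMonoid Γ] [CanonicallyOrderedAdd Γ] [Semiring R] (x : HahnSeries Γ R) :
    single x.order 1 * divMonomial x.order x = x := by
  ext a
  rcases le_or_gt x.order a with h | h
  · obtain ⟨b, rfl⟩ := exists_add_of_le h
    rw [add_comm, coeff_single_mul_add, one_mul, add_comm]
    rfl
  · rw [coeff_eq_zero_of_lt_order h, coeff_mul]
    refine Finset.sum_eq_zero fun p hp => ?_
    rw [Finset.mem_antidiagonal] at hp
    have h1 : p.1 = x.order := by
      by_contra hne
      exact hp.1 (coeff_single_of_ne hne)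
    exact absurd (h1 ▸ hp.2.2 ▸ le_self_add : x.order ≤ a) h.not_ge

theorem isUnit_divMonomial_order {Γ K : Type*} [AddCommMonoid Γ] [LinearOrder Γ]
    [IsOrderedCancelAddMonoid Γ] [CanonicallyOrderedAdd Γ] [Field K] {x : HahnSeries Γ K}
    (hx : x ≠ 0) : IsUnit (divMonomial x.order x) := by
  have h0 : (divMonomial x.order x).coeff 0 ≠ 0 := by
    simpa [divMonomial] using coeff_order_eq_zero.not.2 hx
  have hne : divMonomial x.order x ≠ 0 := fun h => h0 (by simp [h])
  refine isUnit_of_isUnit_leadingCoeff_AddUnitOrder (leadingCoeff_ne_zero.2 hne).isUnit ?_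
  rw [nonpos_iff_eq_zero.1 (order_le_of_coeff_ne_zero h0)]
  exact isAddUnit_zero

end HahnSeries

/-- Every nonzero `F` in `ℝ⟦X*⟧ = HahnSeries ℝ≥0 ℝ` is normal:
`F = X^γ · U` with `γ = order F` and `U` a unit of the ring. -/
theorem hahnSeries_eq_monomial_mul_unit (F : HahnSeries NNReal ℝ) (hF : F ≠ 0) :
    ∃ U : (HahnSeries NNReal ℝ)ˣ,
      F = (HahnSeries.single F.order (1 : ℝ)) * (U : HahnSeries NNReal ℝ) := by
  obtain ⟨U, hU⟩ := HahnSeries.isUnit_divMonomial_order hF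
  exact ⟨U, by rw [hU, HahnSeries.single_mul_divMonomial_order]⟩
end

section
/- Let m ∈ ℕ and let F be an element of the ring ℝ⟦X₁*,…,X_m*⟧ of formal generalised power series in m variables (the Hahn series ring HahnSeries (Fin m → ℝ≥0) ℝ over the coordinatewise-ordered monoid Fin m → ℝ≥0). Then F is a unit of this ring if and only if the coefficient of F at the exponent 0 is nonzero. -/
namespace HahnSeries

variable {Γ R : Type*} [AddCommMonoid Γ] [PartialOrder Γ] [IsOrderedCancelAddMonoid Γ]

theorem isPWO_iUnion_support_pow_of_pos [Semiring R] {x : HahnSeries Γ R}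
    (hx : ∀ g ∈ x.support, 0 < g) : (⋃ n : ℕ, (x ^ n).support).IsPWO :=
  (x.isPWO_support.addSubmonoid_closure fun g hg => (hx g hg).le).mono
    (Set.iUnion_subset fun n => SummableFamily.support_pow_subset_closure x n)

theorem finite_setOf_coeff_pow_ne_zero_of_pos [Semiring R] {x : HahnSeries Γ R}
    (hx : ∀ g ∈ x.support, 0 < g) (g : Γ) : {n : ℕ | (x ^ n).coeff g ≠ 0}.Finite := by
  have hpwo := isPWO_iUnion_support_pow_of_pos hx
  by_cases hg : g ∈ ⋃ n : ℕ, (x ^ n).support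
  swap
  · exact Set.finite_empty.subset fun n hn => hg (Set.mem_iUnion.2 ⟨n, hn⟩)
  apply hpwo.isWF.induction hg
  intro y _ ih
  refine ((((Finset.antidiagonal hpwo x.isPWO_support y).finite_toSet.biUnion
    fun ij hij => ih ij.1 (Finset.mem_antidiagonal.1 (Finset.mem_coe.1 hij)).1 ?_).image
      Nat.succ).union (Set.finite_singleton 0)).subset ?_
  · obtain ⟨-, hj, rfl⟩ := Finset.mem_antidiagonal.1 (Finset.mem_coe.1 hij)
    exact lt_add_of_pos_right ij.1 (hx _ hj)
  · rintro (_ | n) hn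
    · exact Set.mem_union_right _ (Set.mem_singleton 0)
    · have hn' : y ∈ (x ^ n * x).support := by rwa [← pow_succ]
      obtain ⟨i, hi, j, hj, hij⟩ := support_mul_subset hn'
      refine Set.mem_union_left _ ⟨n, Set.mem_iUnion₂.2 ⟨(i, j), ?_, hi⟩, rfl⟩
      exact Finset.mem_coe.2 (Finset.mem_antidiagonal.2 ⟨Set.mem_iUnion.2 ⟨n, hi⟩, hj, hij⟩)

/-- The geometric family `1, x, x ^ 2, …` of a Hahn series with positive exponents. -/
noncomputable def geometricFamily [Semiring R] (x : HahnSeries Γ R) (hx : ∀ g ∈ x.support, 0 < g) :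
    SummableFamily Γ R ℕ where
  toFun n := x ^ n
  isPWO_iUnion_support' := isPWO_iUnion_support_pow_of_pos hx
  finite_co_support' := finite_setOf_coeff_pow_ne_zero_of_pos hx

theorem one_sub_mul_hsum_geometricFamily [CommRing R] {x : HahnSeries Γ R}
    (hx : ∀ g ∈ x.support, 0 < g) : (1 - x) * (geometricFamily x hx).hsum = 1 := by
  have h : (x • geometricFamily x hx).embDomain ⟨Nat.succ, Nat.succ_injective⟩ =
      geometricFamily x hx - SummableFamily.ofFinsupp (Finsupp.single 0 1) := by
    apply SummableFamily.ext
    rintro (_ | n)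
    · simp [geometricFamily]
    · simp [geometricFamily, SummableFamily.embDomain_apply, of_symm_smul_of_eq_mul, pow_succ',
        -smul_eq_mul]
  rw [← SummableFamily.hsum_smul, sub_smul 1 x (geometricFamily x hx), one_smul, SummableFamily.hsum_sub,
    ← SummableFamily.hsum_embDomain (x • geometricFamily x hx) ⟨Nat.succ, Nat.succ_injective⟩, h]
  simp

theorem coeff_zero_mul_of_canonicallyOrdered [CanonicallyOrderedAdd Γ] [Semiring R]
    (x y : HahnSeries Γ R) : (x * y).coeff 0 = x.coeff 0 * y.coeff 0 := by
  rw [coeff_mul, Finset.sum_eq_single (0, 0)]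
  · rintro ⟨i, j⟩ hij hne
    have h := (Finset.mem_antidiagonal.1 hij).2.2
    exact absurd (Prod.ext_iff.2 (add_eq_zero.1 h)) hne
  · intro h
    by_contra hne
    exact h (Finset.mem_antidiagonal.2
      ⟨left_ne_zero_of_mul hne, right_ne_zero_of_mul hne, add_zero 0⟩)

theorem isUnit_iff_isUnit_coeff_zero_of_canonicallyOrdered [CanonicallyOrderedAdd Γ] [CommRing R]
    {x : HahnSeries Γ R} : IsUnit x ↔ IsUnit (x.coeff 0) := by
  constructor
  · intro hx
    obtain ⟨y, hy⟩ := hx.exists_right_inv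
    refine .of_mul_eq_one (y.coeff 0) ?_
    rw [← coeff_zero_mul_of_canonicallyOrdered, hy, coeff_one, if_pos rfl]
  · intro hx
    obtain ⟨r, hr⟩ := hx.exists_right_inv
    have hpos : ∀ g ∈ (1 - x * C r).support, 0 < g := by
      intro g hg
      refine pos_iff_ne_zero.2 ?_
      rintro rfl
      refine hg ?_
      rw [coeff_sub, coeff_zero_mul_of_canonicallyOrdered]
      simp [hr]
    have h := one_sub_mul_hsum_geometricFamily hpos
    rw [sub_sub_cancel, mul_assoc] at h
    exact .of_mul_eq_one _ h

end HahnSeries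

/-- In the ring `ℝ⟦X₁*,…,X_m*⟧ = HahnSeries (Fin m → ℝ≥0) ℝ` of
formal generalised power series in `m` variables (with the coordinatewise
order on exponents), `F` is a unit if and only if its coefficient at the
exponent `0` is nonzero. -/
theorem hahnSeries_isUnit_iff_coeff_zero_ne_zero (m : ℕ)
    (F : HahnSeries (Fin m → NNReal) ℝ) :
    IsUnit F ↔ F.coeff 0 ≠ 0 := by
  rw [HahnSeries.isUnit_iff_isUnit_coeff_zero_of_canonicallyOrdered, isUnit_iff_ne_zero]
end

section
/- Let A be a nonempty index set and let (F_α)_{α ∈ A} be a family of elements of the ring ℝ⟦X*⟧ of formal generalised power series in one variable (the Hahn series ring HahnSeries ℝ≥0 ℝ). Assume the family has good total support, i.e. there is a subset S ⊆ [0,∞) well-founded under < that contains the support of every F_α. Then there exists α₀ ∈ A such that F_{α₀} divides F_α for every α ∈ A; in particular, the ideal of ℝ⟦X*⟧ generated by {F_α : α ∈ A} is principal. -/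
/-- A Hahn series over `ℝ≥0` whose support is bounded below by `g` is divisible by the
monomial of exponent `g`; the quotient is obtained by shifting the exponents by `g`. -/
theorem HahnSeries.exists_eq_single_mul_of_le_support {R : Type*} [Semiring R]
    {x : HahnSeries NNReal R} {g : NNReal} (h : ∀ i ∈ x.support, g ≤ i) :
    ∃ y : HahnSeries NNReal R, x = single g 1 * y ∧ ∀ j, y.coeff j = x.coeff (g + j) := by
  have hwf : (Function.support fun j => x.coeff (g + j)).IsPWO := by
    refine Set.IsWF.isPWO ?_
    have hx := Set.wellFoundedOn_iff.1 x.isWF_support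
    refine Set.wellFoundedOn_iff.2 (Subrelation.wf ?_ (InvImage.wf (g + ·) hx))
    rintro a b ⟨hab, ha, hb⟩
    exact ⟨add_lt_add_right hab g, ha, hb⟩
  refine ⟨⟨fun j => x.coeff (g + j), hwf⟩, ?_, fun _ => rfl⟩
  ext i
  by_cases hi : g ≤ i
  · obtain ⟨j, rfl⟩ := exists_add_of_le hi
    rw [add_comm g j, coeff_single_mul_add, one_mul, add_comm j g]
  · rw [show x.coeff i = 0 by by_contra hne; exact hi (h i hne), coeff_mul]
    refine (Finset.sum_eq_zero ?_).symm
    rintro ⟨a, b⟩ hab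
    obtain ⟨ha, -, hsum⟩ := Finset.mem_antidiagonal.1 hab
    obtain rfl : a = g := support_single_subset ha
    exact absurd (hsum ▸ le_self_add) hi

/-- If the least exponent of `x` is `g`, then `x` divides every Hahn series over `ℝ≥0` whose
support is bounded below by `g`. -/
theorem HahnSeries.dvd_of_le_support {K : Type*} [Field K]
    {x y : HahnSeries NNReal K} {g : NNReal} (hg : g ∈ x.support)
    (hx : ∀ i ∈ x.support, g ≤ i) (hy : ∀ i ∈ y.support, g ≤ i) : x ∣ y := by
  obtain ⟨u, rfl, hu⟩ := exists_eq_single_mul_of_le_support hx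
  obtain ⟨v, rfl, -⟩ := exists_eq_single_mul_of_le_support hy
  have hu0 : u.coeff 0 ≠ 0 := by rw [hu, add_zero]; exact hg
  have hne : u ≠ 0 := by rintro rfl; exact hu0 rfl
  have hord : u.order = 0 := le_antisymm (order_le_of_coeff_ne_zero hu0) zero_le
  have hunit : IsUnit u :=
    isUnit_of_isUnit_leadingCoeff_AddUnitOrder (leadingCoeff_ne_zero.2 hne).isUnit
      (hord ▸ isAddUnit_zero)
  exact mul_dvd_mul_left _ hunit.dvd

/-- If a family `(F_α)_{α ∈ A}` in `ℝ⟦X*⟧ = HahnSeries ℝ≥0 ℝ` has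
good total support (all supports contained in one subset of `[0,∞)`
well-founded under `<`), then some `F_{α₀}` divides every `F_α`; in
particular the ideal generated by the family is principal. -/
theorem hahnSeries_family_principal {A : Type*} [Nonempty A]
    (F : A → HahnSeries NNReal ℝ) (S : Set NNReal)
    (hS : S.WellFoundedOn (· < ·)) (hsupp : ∀ α, (F α).support ⊆ S) :
    ∃ α₀ : A, (∀ α, F α₀ ∣ F α) ∧
      Ideal.span (Set.range F) = Ideal.span {F α₀} := by
  suffices h : ∃ α₀ : A, ∀ α, F α₀ ∣ F α by
    obtain ⟨α₀, h⟩ := h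
    refine ⟨α₀, h, le_antisymm (Ideal.span_le.2 ?_)
      (Ideal.span_mono (Set.singleton_subset_iff.2 ⟨α₀, rfl⟩))⟩
    rintro _ ⟨α, rfl⟩
    exact Ideal.mem_span_singleton.2 (h α)
  by_cases hne : (⋃ α, (F α).support).Nonempty
  · have hwf : (⋃ α, (F α).support).IsWF := Set.IsWF.mono hS (Set.iUnion_subset hsupp)
    obtain ⟨α₀, hα₀⟩ := Set.mem_iUnion.1 (hwf.min_mem hne)
    have hmin (α : A) : ∀ i ∈ (F α).support, hwf.min hne ≤ i := fun i hi =>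
      hwf.min_le hne (Set.mem_iUnion.2 ⟨α, hi⟩)
    exact ⟨α₀, fun α => HahnSeries.dvd_of_le_support hα₀ (hmin α₀) (hmin α)⟩
  · have hzero (α : A) : F α = 0 := by
      rw [← HahnSeries.support_eq_empty_iff, Set.eq_empty_iff_forall_notMem]
      exact fun i hi => hne ⟨i, Set.mem_iUnion.2 ⟨α, hi⟩⟩
    exact ⟨Classical.arbitrary A, fun α => hzero α ▸ dvd_zero _⟩
end

section
/- Define f : ℝ → ℝ by f(t) = Σ_{n=0}^∞ Σ_{i=0}^∞ (1/2^i) · t^{2 + n − 1/2^i}, where t^β denotes the real power (rpow) for t ≥ 0. Then: (i) for every t with 0 ≤ t < 1 the doubly indexed family (n,i) ↦ (1/2^i)·t^{2+n−1/2^i} is summable; and (ii) for every x with 0 ≤ x < 1, f satisfies the functional equation (1 − x)·f(x) = x + (1/2)·x·(1 − √x)·f(√x). -/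
lemma one_div_two_pow_le_one (i : ℕ) : (1 / 2 ^ i : ℝ) ≤ 1 := by
  rw [← one_div_pow]
  exact pow_le_one₀ (by norm_num) (by norm_num)

lemma summable_one_div_two_pow_mul_rpow {t : ℝ} (h0 : 0 ≤ t) (h1 : t ≤ 1) :
    Summable (fun i : ℕ => (1 / 2 ^ i : ℝ) * t ^ (2 - 1 / 2 ^ i : ℝ)) := by
  refine Summable.of_nonneg_of_le (fun i => by positivity) (fun i => ?_) summable_geometric_two
  rw [one_div_pow]
  have h := one_div_two_pow_le_one i
  exact mul_le_of_le_one_right (by positivity) (Real.rpow_le_one h0 h1 (by linarith))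

lemma one_div_two_pow_mul_rpow_eq_mul {t : ℝ} (h0 : 0 ≤ t) (n i : ℕ) :
    (1 / 2 ^ i : ℝ) * t ^ (2 + (n : ℝ) - 1 / 2 ^ i) =
      t ^ n * ((1 / 2 ^ i : ℝ) * t ^ (2 - 1 / 2 ^ i : ℝ)) := by
  have h := one_div_two_pow_le_one i
  have he : 2 + (n : ℝ) - 1 / 2 ^ i = n + (2 - 1 / 2 ^ i) := by ring
  rw [he, Real.rpow_add_of_nonneg h0 n.cast_nonneg (by linarith), Real.rpow_natCast]
  ring

lemma summable_generalised_series {t : ℝ} (h0 : 0 ≤ t) (h1 : t < 1) :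
    Summable (fun p : ℕ × ℕ =>
      (1 / 2 ^ p.2 : ℝ) * t ^ (2 + (p.1 : ℝ) - 1 / 2 ^ p.2)) := by
  simp_rw [one_div_two_pow_mul_rpow_eq_mul h0]
  exact (summable_geometric_of_lt_one h0 h1).mul_of_nonneg
    (summable_one_div_two_pow_mul_rpow h0 h1.le)
    (fun n => pow_nonneg h0 n) (fun i => by dsimp only [Pi.zero_apply]; positivity)

lemma one_sub_mul_tsum_generalised_series {t : ℝ} (h0 : 0 ≤ t) (h1 : t < 1) :
    (1 - t) * ∑' p : ℕ × ℕ, (1 / 2 ^ p.2 : ℝ) * t ^ (2 + (p.1 : ℝ) - 1 / 2 ^ p.2) =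
      ∑' i : ℕ, (1 / 2 ^ i : ℝ) * t ^ (2 - 1 / 2 ^ i : ℝ) := by
  have hs := summable_generalised_series h0 h1
  simp_rw [one_div_two_pow_mul_rpow_eq_mul h0] at hs ⊢
  rw [← (summable_geometric_of_lt_one h0 h1).tsum_mul_tsum
    (summable_one_div_two_pow_mul_rpow h0 h1.le) hs, tsum_geometric_of_lt_one h0 h1,
    mul_inv_cancel_left₀ (by linarith)]

lemma mul_sqrt_rpow {x : ℝ} (h0 : 0 ≤ x) {a : ℝ} (ha : a ≤ 2) :
    x * √x ^ (2 - a) = x ^ (2 - a / 2) := by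
  have he : 2 - a / 2 = 1 + 1 / 2 * (2 - a) := by ring
  rw [he, Real.rpow_add_of_nonneg h0 zero_le_one (by linarith), Real.rpow_one,
    Real.rpow_mul h0, Real.sqrt_eq_rpow]


/-- The generalised power series
`f(t) = Σ_{n,i} 2^{−i} t^{2+n−2^{−i}}` is given by a summable family for
`0 ≤ t < 1`, and satisfies the functional equation
`(1 − x)·f(x) = x + (1/2)·x·(1 − √x)·f(√x)` for `0 ≤ x < 1`. -/
theorem generalised_series_functional_equation (f : ℝ → ℝ)
    (hf : ∀ t : ℝ, f t =
      ∑' p : ℕ × ℕ, (1 / 2 ^ p.2 : ℝ) * t ^ (2 + (p.1 : ℝ) - 1 / 2 ^ p.2)) :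
    (∀ t : ℝ, 0 ≤ t → t < 1 →
      Summable (fun p : ℕ × ℕ =>
        (1 / 2 ^ p.2 : ℝ) * t ^ (2 + (p.1 : ℝ) - 1 / 2 ^ p.2))) ∧
    (∀ x : ℝ, 0 ≤ x → x < 1 →
      (1 - x) * f x = x + (1 / 2) * x * (1 - Real.sqrt x) * f (Real.sqrt x)) := by
  refine ⟨fun t => summable_generalised_series, fun x h0 h1 => ?_⟩
  have hs1 : √x < 1 := (Real.sqrt_lt' one_pos).2 (by simpa using h1)
  rw [mul_assoc (1 / 2 * x), hf, hf, one_sub_mul_tsum_generalised_series h0 h1,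
    one_sub_mul_tsum_generalised_series x.sqrt_nonneg hs1,
    (summable_one_div_two_pow_mul_rpow h0 h1.le).tsum_eq_zero_add, ← tsum_mul_left]
  congr 1
  · norm_num
  · refine tsum_congr fun i => ?_
    have h := one_div_two_pow_le_one i
    have hc : (1 / 2 ^ (i + 1) : ℝ) = 1 / 2 ^ i / 2 := by rw [pow_succ, div_div]
    rw [hc, ← mul_sqrt_rpow h0 (by linarith)]
    ring
end

section
/- Let m ∈ ℕ, let ι be a countable index set, let α : ι → (Fin m → ℝ) be a family of exponent vectors with α(k)_j ≥ 0 for all k and j, let c : ι → ℝ be a family of coefficients, and let r ∈ (0,∞)^m be a polyradius. Assume that the family k ↦ |c(k)| · Π_{j} r_j^{α(k)_j} is summable. Then the function F(x) = Σ_{k ∈ ι} c(k) · Π_{j} x_j^{α(k)_j} is well defined (the family is summable at each point) and continuous on the box {x ∈ ℝ^m : 0 ≤ x_j ≤ r_j for all j}. -/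
/-- A convergent generalised power series `Σ_k c_k x^{α_k}`
(nonnegative exponent vectors, countably many terms, with
`Σ_k |c_k| r^{α_k} < ∞` for a polyradius `r`) defines, via a family that is
summable at every point of the box `{0 ≤ x ≤ r}`, a continuous function on
that box. -/
theorem generalised_power_series_continuousOn (m : ℕ) {ι : Type*} [Countable ι]
    (α : ι → Fin m → ℝ) (hα : ∀ k j, 0 ≤ α k j)
    (c : ι → ℝ) (r : Fin m → ℝ) (hr : ∀ j, 0 < r j)
    (hsum : Summable fun k => |c k| * ∏ j, r j ^ α k j) :
    (∀ x : Fin m → ℝ, (∀ j, 0 ≤ x j ∧ x j ≤ r j) →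
      Summable fun k => c k * ∏ j, x j ^ α k j) ∧
    ContinuousOn (fun x : Fin m → ℝ => ∑' k, c k * ∏ j, x j ^ α k j)
      {x : Fin m → ℝ | ∀ j, 0 ≤ x j ∧ x j ≤ r j} := by
  have bound : ∀ k, ∀ x ∈ {x : Fin m → ℝ | ∀ j, 0 ≤ x j ∧ x j ≤ r j},
      ‖c k * ∏ j, x j ^ α k j‖ ≤ |c k| * ∏ j, r j ^ α k j := by
    intro k x hx
    have hnn : 0 ≤ ∏ j, x j ^ α k j :=
      Finset.prod_nonneg fun j _ => Real.rpow_nonneg (hx j).1 _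
    rw [Real.norm_eq_abs, abs_mul, abs_of_nonneg hnn]
    exact mul_le_mul_of_nonneg_left
      (Finset.prod_le_prod (fun j _ => Real.rpow_nonneg (hx j).1 _)
        fun j _ => Real.rpow_le_rpow (hx j).1 (hx j).2 (hα k j))
      (abs_nonneg _)
  refine ⟨fun x hx => hsum.of_norm_bounded fun k => bound k x hx,
    continuousOn_tsum (fun k => Continuous.continuousOn ?_) hsum bound⟩
  exact continuous_const.mul <| continuous_finsetProd _ fun j _ =>
    (Real.continuous_rpow_const (hα k j)).comp (continuous_apply j)
end
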